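/- Let (Ξ, 𝒢, ν) be a probability space, p ≥ 1, and let Φ₁, Φ₂ : Ξ → ℝ^p be measurable with ∫‖Φ₁‖² dν < ∞ and ∫‖Φ₂‖² dν < ∞; set m₁ := ∫Φ₁ dν and m₂ := ∫Φ₂ dν. Let v ∈ ℝ^p and let b ≥ 1 be a natural number. Then, integrating over the product measure ν^{⊗b} on Ξ^b, ∫_{Ξ^b}‖v + (1/b)·∑_{i=1}^{b}(Φ₁(ξᵢ) − Φ₂(ξᵢ)) − m₁‖² dν^{⊗b}(ξ) = ‖v − m₂‖² + (1/b)·(∫‖Φ₁ − Φ₂‖² dν − ‖m₁ − m₂‖²); in particular this quantity is at most ‖v − m₂‖² + (1/b)·∫‖Φ₁ − Φ₂‖² dν. -/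

import Mathlib

open MeasureTheory

open ProbabilityTheory in
/-- Second moment of a shifted empirical mean of `b` i.i.d. real samples. -/
lemma integral_sq_add_empirical_mean {Ξ : Type*} [MeasurableSpace Ξ] (ν : Measure Ξ)
    [IsProbabilityMeasure ν] {f : Ξ → ℝ} (hf : MemLp f 2 ν) (c : ℝ) {b : ℕ} (hb : b ≠ 0) :
    (∫ ξ : Fin b → Ξ, (c + (1 / (b : ℝ)) * ∑ i, f (ξ i)) ^ 2 ∂(Measure.pi fun _ : Fin b => ν))
      = (c + ∫ t, f t ∂ν) ^ 2
        + (1 / (b : ℝ)) * ((∫ t, f t ^ 2 ∂ν) - (∫ t, f t ∂ν) ^ 2) := by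
  have hb' : (b : ℝ) ≠ 0 := Nat.cast_ne_zero.mpr hb
  have hcoord (i : Fin b) :
      MemLp (fun ξ : Fin b → Ξ => f (ξ i)) 2 (Measure.pi fun _ : Fin b => ν) :=
    hf.comp_measurePreserving (measurePreserving_eval (fun _ : Fin b => ν) i)
  have hsum : MemLp (fun ξ : Fin b → Ξ => (1 / (b : ℝ)) * ∑ i, f (ξ i)) 2
      (Measure.pi fun _ : Fin b => ν) :=
    (memLp_finsetSum Finset.univ fun i _ => hcoord i).const_mul _
  have hmean : ∫ ξ : Fin b → Ξ, (c + (1 / (b : ℝ)) * ∑ i, f (ξ i))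
      ∂(Measure.pi fun _ : Fin b => ν) = c + ∫ t, f t ∂ν := by
    rw [integral_add (integrable_const c) (hsum.integrable one_le_two), integral_const_mul,
      integral_finsetSum _ fun i _ => (hcoord i).integrable one_le_two]
    simp only [integral_comp_eval (μ := fun _ : Fin b => ν) hf.aestronglyMeasurable]
    simp [hb']
  have hvar : Var[fun ξ : Fin b → Ξ => c + (1 / (b : ℝ)) * ∑ i, f (ξ i);
      Measure.pi fun _ : Fin b => ν] = (1 / (b : ℝ)) * Var[f; ν] := by
    have hpi := variance_sum_pi (μ := fun _ : Fin b => ν) (X := fun _ => f) fun _ => hf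
    rw [Finset.sum_fn] at hpi
    rw [variance_const_add hsum.aestronglyMeasurable, variance_const_mul, hpi]
    simp
    field_simp
  have hshift : MemLp (fun ξ : Fin b → Ξ => c + (1 / (b : ℝ)) * ∑ i, f (ξ i)) 2
      (Measure.pi fun _ : Fin b => ν) := (memLp_const c).add hsum
  rw [variance_eq_sub hshift, variance_eq_sub hf, hmean] at hvar
  simp only [Pi.pow_apply] at hvar
  linarith

/-- Second moment of a shifted empirical mean of `b` i.i.d. Euclidean samples. -/
lemma integral_norm_sq_add_empirical_mean {ι Ξ : Type*} [Fintype ι] [MeasurableSpace Ξ]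
    (ν : Measure Ξ) [IsProbabilityMeasure ν] {g : Ξ → EuclideanSpace ℝ ι} (hg : MemLp g 2 ν)
    (c : EuclideanSpace ℝ ι) {b : ℕ} (hb : b ≠ 0) :
    (∫ ξ : Fin b → Ξ, ‖c + (1 / (b : ℝ)) • ∑ i, g (ξ i)‖ ^ 2 ∂(Measure.pi fun _ : Fin b => ν))
      = ‖c + ∫ t, g t ∂ν‖ ^ 2
        + (1 / (b : ℝ)) * ((∫ t, ‖g t‖ ^ 2 ∂ν) - ‖∫ t, g t ∂ν‖ ^ 2) := by
  have hcoord (j : ι) : MemLp (fun t => g t j) 2 ν := hg.eval_piLp j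
  have hmean (j : ι) : (∫ t, g t ∂ν) j = ∫ t, g t j ∂ν :=
    eval_integral_piLp (fun j => (hcoord j).integrable one_le_two) j
  have hemp (j : ι) : MemLp (fun ξ : Fin b → Ξ => c j + (1 / (b : ℝ)) * ∑ i, g (ξ i) j) 2
      (Measure.pi fun _ : Fin b => ν) :=
    (memLp_const (c j)).add <| (memLp_finsetSum Finset.univ fun i _ =>
      (hcoord j).comp_measurePreserving
        (measurePreserving_eval (fun _ : Fin b => ν) i)).const_mul _
  simp only [EuclideanSpace.real_norm_sq_eq, PiLp.add_apply, PiLp.smul_apply, smul_eq_mul,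
    WithLp.ofLp_sum, Finset.sum_apply, hmean]
  rw [integral_finsetSum _ fun j _ => (hemp j).integrable_sq,
    integral_finsetSum _ fun j _ => (hcoord j).integrable_sq,
    ← Finset.sum_sub_distrib, Finset.mul_sum, ← Finset.sum_add_distrib]
  exact Finset.sum_congr rfl fun j _ => integral_sq_add_empirical_mean ν (hcoord j) (c j) hb

/-- One-step variance identity/bound underlying the Loopless-SARAH estimator. -/
theorem stmt_19 (p : ℕ) (hp : 1 ≤ p)
    {Ξ : Type*} [MeasurableSpace Ξ] (ν : Measure Ξ) [IsProbabilityMeasure ν]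
    (Φ₁ Φ₂ : Ξ → EuclideanSpace ℝ (Fin p))
    (hΦ₁ : Measurable Φ₁) (hΦ₂ : Measurable Φ₂)
    (h1 : Integrable (fun ξ => ‖Φ₁ ξ‖ ^ 2) ν)
    (h2 : Integrable (fun ξ => ‖Φ₂ ξ‖ ^ 2) ν)
    (v : EuclideanSpace ℝ (Fin p)) (b : ℕ) (hb : 1 ≤ b) :
    (∫ ξ : Fin b → Ξ,
        ‖v + (1 / (b : ℝ)) • (∑ i, (Φ₁ (ξ i) - Φ₂ (ξ i))) - ∫ t, Φ₁ t ∂ν‖ ^ 2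
        ∂(Measure.pi fun _ : Fin b => ν))
      = ‖v - ∫ t, Φ₂ t ∂ν‖ ^ 2
        + (1 / (b : ℝ)) * ((∫ t, ‖Φ₁ t - Φ₂ t‖ ^ 2 ∂ν)
            - ‖(∫ t, Φ₁ t ∂ν) - ∫ t, Φ₂ t ∂ν‖ ^ 2)
    ∧ (∫ ξ : Fin b → Ξ,
        ‖v + (1 / (b : ℝ)) • (∑ i, (Φ₁ (ξ i) - Φ₂ (ξ i))) - ∫ t, Φ₁ t ∂ν‖ ^ 2
        ∂(Measure.pi fun _ : Fin b => ν))
      ≤ ‖v - ∫ t, Φ₂ t ∂ν‖ ^ 2 + (1 / (b : ℝ)) * ∫ t, ‖Φ₁ t - Φ₂ t‖ ^ 2 ∂ν := by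
  have hL1 : MemLp Φ₁ 2 ν := (memLp_two_iff_integrable_sq_norm hΦ₁.aestronglyMeasurable).2 h1
  have hL2 : MemLp Φ₂ 2 ν := (memLp_two_iff_integrable_sq_norm hΦ₂.aestronglyMeasurable).2 h2
  have hsub : ∫ t, (Φ₁ t - Φ₂ t) ∂ν = (∫ t, Φ₁ t ∂ν) - ∫ t, Φ₂ t ∂ν :=
    integral_sub (hL1.integrable one_le_two) (hL2.integrable one_le_two)
  have key := integral_norm_sq_add_empirical_mean ν (g := fun t => Φ₁ t - Φ₂ t) (hL1.sub hL2)
    (v - ∫ t, Φ₁ t ∂ν) (Nat.one_le_iff_ne_zero.mp hb)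
  rw [hsub, sub_add_sub_cancel] at key
  simp only [sub_add_eq_add_sub] at key
  refine ⟨key, key.trans_le ?_⟩
  gcongr
  exact sub_le_self _ (by positivity)
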